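/- Fix probability vectors p = (p_w, p_d, p_ℓ) and q = (q_w, q_d, q_ℓ). If the defensive style is safe, i.e. q_d = 1, and 0 < p_ℓ with p_w ≤ p_ℓ, then the gain of the catenaccio policy converges as the horizon N tends to infinity: g_N^(cat) → 2·p_w/p_ℓ − 1. -/

import Mathlib

noncomputable section

open Filter Topology Finset

/-- The sign of an integer score, as a real number (`sgn 0 = 0`). -/
def sgn (x : ℤ) : ℝ := if 0 < x then 1 else if x < 0 then -1 else 0

/-- Expected sign of the score after one more game played with win/draw/loss
probabilities `w, d, l`, starting from score `x`. -/
def stepVal (w d l : ℝ) (x : ℤ) : ℝ := w * sgn (x + 1) + d * sgn x + l * sgn (x - 1)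

/-- Bellman value function with `k` games remaining: `bellman p q k x = V_{N-k}^N(x)`.
With no game remaining the value is the sign of the score; otherwise Player 1 picks the
better of the offensive style `(pw, pd, pl)` and the defensive style `(qw, qd, ql)`. -/
def bellman (pw pd pl qw qd ql : ℝ) : ℕ → ℤ → ℝ
  | 0, x => sgn x
  | k + 1, x =>
      max
        (pw * bellman pw pd pl qw qd ql k (x + 1) + pd * bellman pw pd pl qw qd ql k x +
          pl * bellman pw pd pl qw qd ql k (x - 1))
        (qw * bellman pw pd pl qw qd ql k (x + 1) + qd * bellman pw pd pl qw qd ql k x +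
          ql * bellman pw pd pl qw qd ql k (x - 1))

/-- Optimal gain over `N` games: `g*_N = V_0^N(0)`. -/
def gOpt (pw pd pl qw qd ql : ℝ) (N : ℕ) : ℝ := bellman pw pd pl qw qd ql N 0

/-- The two playing styles of Player 1. -/
inductive Style
  | offense
  | defense
deriving DecidableEq

/-- Selects the probability attached to a style: `a` for offense, `b` for defense. -/
def styleP (a b : ℝ) : Style → ℝ
  | .offense => a
  | .defense => b

/-- Probability mass function of the score process `X_n` under the policy `π`
(playing `π n x` at round `n+1` when the current score is `x`), started at `X_0 = 0`. -/
def polDist (pw pd pl qw qd ql : ℝ) (π : ℕ → ℤ → Style) : ℕ → ℤ → ℝ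
  | 0, x => if x = 0 then 1 else 0
  | n + 1, x =>
      polDist pw pd pl qw qd ql π n (x - 1) * styleP pw qw (π n (x - 1)) +
      polDist pw pd pl qw qd ql π n x * styleP pd qd (π n x) +
      polDist pw pd pl qw qd ql π n (x + 1) * styleP pl ql (π n (x + 1))

/-- Gain of policy `π` over `n` games: `g_n^π = E[sign (X_n)]`. -/
def gPol (pw pd pl qw qd ql : ℝ) (π : ℕ → ℤ → Style) (n : ℕ) : ℝ :=
  ∑' x : ℤ, polDist pw pd pl qw qd ql π n x * sgn x

/-- Probability mass function of the pair (score, switched-to-defense flag) under the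
catenaccio policy: play offense until the score first reaches `+1`, then defense forever. -/
def catDist (pw pd pl qw qd ql : ℝ) : ℕ → ℤ → Bool → ℝ
  | 0, x, b => if x = 0 ∧ b = false then 1 else 0
  | n + 1, x, true =>
      catDist pw pd pl qw qd ql n (x - 1) true * qw +
      catDist pw pd pl qw qd ql n x true * qd +
      catDist pw pd pl qw qd ql n (x + 1) true * ql +
      (if x = 1 then
        catDist pw pd pl qw qd ql n 0 false * pw +
        catDist pw pd pl qw qd ql n 1 false * pd +
        catDist pw pd pl qw qd ql n 2 false * pl
       else 0)
  | n + 1, x, false =>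
      if x = 1 then 0
      else
        catDist pw pd pl qw qd ql n (x - 1) false * pw +
        catDist pw pd pl qw qd ql n x false * pd +
        catDist pw pd pl qw qd ql n (x + 1) false * pl

/-- Gain of the catenaccio policy over `N` games: `g_N^(cat) = E[sign (X_N)]`. -/
def gCat (pw pd pl qw qd ql : ℝ) (N : ℕ) : ℝ :=
  ∑' x : ℤ,
    (catDist pw pd pl qw qd ql N x false + catDist pw pd pl qw qd ql N x true) * sgn x

/-- Gain of the catenaccio+ policy over `N` games: play catenaccio, except that if the
score after `N - 1` games is `0`, the last game is played with the better of the two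
styles (offense if `pw - pl > qw - ql`, defense otherwise). -/
def gCatPlus (pw pd pl qw qd ql : ℝ) : ℕ → ℝ
  | 0 => 0
  | N + 1 =>
      ∑' x : ℤ,
        (catDist pw pd pl qw qd ql N x false *
            (if x = 0 then (if pw - pl > qw - ql then pw - pl else qw - ql)
             else stepVal pw pd pl x) +
          catDist pw pd pl qw qd ql N x true *
            (if x = 0 then (if pw - pl > qw - ql then pw - pl else qw - ql)
             else stepVal qw qd ql x))

/-- Probability mass function of the lazy random walk with i.i.d. increments (+1 with
probability `qw`, 0 with probability `qd`, −1 with probability `ql`), started at `0`. -/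
def walkDist (qw qd ql : ℝ) : ℕ → ℤ → ℝ
  | 0, x => if x = 0 then 1 else 0
  | n + 1, x =>
      walkDist qw qd ql n (x - 1) * qw + walkDist qw qd ql n x * qd +
        walkDist qw qd ql n (x + 1) * ql

/-- Fixed-style gain over `N` games for the walk with step law `(qw, qd, ql)`. -/
def gFixed (qw qd ql : ℝ) (N : ℕ) : ℝ := ∑' x : ℤ, walkDist qw qd ql N x * sgn x

/-- Probability mass function of the lazy random walk with step law `(pw, pd, pl)`,
started at `0` and absorbed (stopped) at the level `+1`.  In particular
`stoppedDist pw pd pl n 1` is the probability that the walk reaches `+1` by time `n`. -/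
def stoppedDist (pw pd pl : ℝ) : ℕ → ℤ → ℝ
  | 0, x => if x = 0 then 1 else 0
  | n + 1, x =>
      if x = 1 then
        stoppedDist pw pd pl n 1 + stoppedDist pw pd pl n 0 * pw +
          stoppedDist pw pd pl n 2 * pl
      else
        (if x - 1 = 1 then 0 else stoppedDist pw pd pl n (x - 1) * pw) +
          stoppedDist pw pd pl n x * pd +
          (if x + 1 = 1 then 0 else stoppedDist pw pd pl n (x + 1) * pl)

section SafeDefense

variable {pw pd pl : ℝ}

/-- With a safe defensive style, a switched player stays at the score `+1`. -/
lemma catDist_safe_true_of_ne_one (n : ℕ) (x : ℤ) (hx : x ≠ 1) :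
    catDist pw pd pl 0 1 0 n x true = 0 := by
  induction n generalizing x with
  | zero => simp [catDist]
  | succ n ih => simp [catDist, hx, ih x hx]

/-- While still attacking, the score after `n` rounds lies in `[-n, 0]`. -/
lemma catDist_false_eq_zero (n : ℕ) (x : ℤ) (hx : 0 < x ∨ x < -(n : ℤ)) :
    catDist pw pd pl 0 1 0 n x false = 0 := by
  induction n generalizing x with
  | zero =>
    have : x ≠ 0 := by rintro rfl; simp at hx
    simp [catDist, this]
  | succ n ih =>
    push_cast at hx
    by_cases h1 : x = 1
    · simp [catDist, h1]
    · simp [catDist, h1, ih x (by lia), ih (x - 1) (by lia), ih (x + 1) (by lia)]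

variable (pw pd pl) in
/-- The probability of still attacking at score `-k` after `n` rounds. -/
def attackMass (n k : ℕ) : ℝ := catDist pw pd pl 0 1 0 n (-(k : ℤ)) false

variable (pw pd pl) in
/-- The probability of having switched to defense within `n` rounds. -/
def switchMass (n : ℕ) : ℝ := catDist pw pd pl 0 1 0 n 1 true

lemma attackMass_eq_zero {n k : ℕ} (h : n < k) : attackMass pw pd pl n k = 0 :=
  catDist_false_eq_zero n _ (by lia)

lemma attackMass_succ_zero (n : ℕ) :
    attackMass pw pd pl (n + 1) 0 =
      attackMass pw pd pl n 1 * pw + attackMass pw pd pl n 0 * pd := by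
  simp [attackMass, catDist, catDist_false_eq_zero n 1]

lemma attackMass_succ_succ (n k : ℕ) :
    attackMass pw pd pl (n + 1) (k + 1) =
      attackMass pw pd pl n (k + 2) * pw + attackMass pw pd pl n (k + 1) * pd +
        attackMass pw pd pl n k * pl := by
  have h1 : -((k + 1 : ℕ) : ℤ) ≠ 1 := by lia
  have h2 : -((k + 1 : ℕ) : ℤ) - 1 = -((k + 2 : ℕ) : ℤ) := by lia
  have h3 : -((k + 1 : ℕ) : ℤ) + 1 = -(k : ℤ) := by lia
  simp only [attackMass, catDist, if_neg h1, h2, h3]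

lemma switchMass_succ (n : ℕ) :
    switchMass pw pd pl (n + 1) = switchMass pw pd pl n + attackMass pw pd pl n 0 * pw := by
  simp [switchMass, attackMass, catDist, catDist_false_eq_zero n 1, catDist_false_eq_zero n 2]

lemma attackMass_nonneg (hpw : 0 ≤ pw) (hpd : 0 ≤ pd) (hpl : 0 ≤ pl) (n k : ℕ) :
    0 ≤ attackMass pw pd pl n k := by
  induction n generalizing k with
  | zero => simp only [attackMass, catDist]; split_ifs <;> norm_num
  | succ n ih =>
    cases k with
    | zero => rw [attackMass_succ_zero]; have := ih 0; have := ih 1; positivity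
    | succ k =>
      rw [attackMass_succ_succ]
      have := ih k; have := ih (k + 1); have := ih (k + 2); positivity

/-- A harmonic weight `H` (with `H 0` the weight of the switched state and `H (k + 1)` that of
the score `-k`) has constant expectation. -/
lemma switchMass_add_sum_eq (H : ℕ → ℝ)
    (hH : ∀ k, H (k + 1) = pw * H k + pd * H (k + 1) + pl * H (k + 2)) (n : ℕ) :
    H 0 * switchMass pw pd pl n +
      ∑ k ∈ range (n + 1), H (k + 1) * attackMass pw pd pl n k = H 1 := by
  induction n with
  | zero => simp [switchMass, attackMass, catDist]
  | succ n ih =>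
    rw [← ih]
    have e1 : ∑ k ∈ range (n + 2), H (k + 1) * attackMass pw pd pl n (k + 1) =
        ∑ k ∈ range (n + 1), H k * attackMass pw pd pl n k - H 0 * attackMass pw pd pl n 0 := by
      rw [eq_sub_iff_add_eq, ← Finset.sum_range_succ' (fun k => H k * attackMass pw pd pl n k),
        Finset.sum_range_succ, Finset.sum_range_succ]
      simp [attackMass_eq_zero]
    have e2 : ∑ k ∈ range (n + 2), H (k + 1) * attackMass pw pd pl n k =
        ∑ k ∈ range (n + 1), H (k + 1) * attackMass pw pd pl n k := by
      rw [Finset.sum_range_succ]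
      simp [attackMass_eq_zero]
    have e3 : ∑ k ∈ range (n + 2), H (k + 1) * attackMass pw pd pl (n + 1) k =
        pw * ∑ k ∈ range (n + 2), H (k + 1) * attackMass pw pd pl n (k + 1) +
        pd * ∑ k ∈ range (n + 2), H (k + 1) * attackMass pw pd pl n k +
        pl * ∑ k ∈ range (n + 1), H (k + 2) * attackMass pw pd pl n k := by
      rw [Finset.sum_range_succ', Finset.sum_range_succ' _ (n + 1),
        Finset.sum_range_succ' _ (n + 1), attackMass_succ_zero]
      simp only [attackMass_succ_succ, mul_add, Finset.mul_sum, Finset.sum_add_distrib]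
      simp only [mul_comm, mul_left_comm, mul_assoc]
      ring
    have e4 : ∑ k ∈ range (n + 1), H (k + 1) * attackMass pw pd pl n k =
        pw * ∑ k ∈ range (n + 1), H k * attackMass pw pd pl n k +
        pd * ∑ k ∈ range (n + 1), H (k + 1) * attackMass pw pd pl n k +
        pl * ∑ k ∈ range (n + 1), H (k + 2) * attackMass pw pd pl n k := by
      simp only [Finset.mul_sum, ← Finset.sum_add_distrib]
      refine Finset.sum_congr rfl fun k _ => ?_
      linear_combination attackMass pw pd pl n k * hH k
    rw [e3, e1, e2, switchMass_succ]
    linear_combination -e4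

lemma switchMass_add_sum_eq_one (hp : pw + pd + pl = 1) (n : ℕ) :
    switchMass pw pd pl n + ∑ k ∈ range (n + 1), attackMass pw pd pl n k = 1 := by
  simpa using switchMass_add_sum_eq (pw := pw) (pd := pd) (pl := pl) (fun _ => 1)
    (fun _ => by linarith) n

lemma switchMass_nonneg (hpw : 0 ≤ pw) (hpd : 0 ≤ pd) (hpl : 0 ≤ pl) (n : ℕ) :
    0 ≤ switchMass pw pd pl n := by
  induction n with
  | zero => simp [switchMass, catDist]
  | succ n ih =>
    rw [switchMass_succ]
    have := attackMass_nonneg hpw hpd hpl n 0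
    positivity

lemma gCat_safe_eq (hp : pw + pd + pl = 1) (n : ℕ) :
    gCat pw pd pl 0 1 0 n = 2 * switchMass pw pd pl n - 1 + attackMass pw pd pl n 0 := by
  have hsum : gCat pw pd pl 0 1 0 n =
      ∑ x ∈ insert (1 : ℤ) ((range (n + 1)).image fun k : ℕ => -(k : ℤ)),
        (catDist pw pd pl 0 1 0 n x false + catDist pw pd pl 0 1 0 n x true) * sgn x := by
    refine tsum_eq_sum fun x hx => ?_
    simp only [Finset.mem_insert, Finset.mem_image, Finset.mem_range, not_or, not_exists,
      not_and] at hx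
    have hx' : 0 < x ∨ x < -(n : ℤ) := by
      by_contra! h
      exact hx.2 x.natAbs (by lia) (by lia)
    simp [catDist_safe_true_of_ne_one n x hx.1, catDist_false_eq_zero n x hx']
  have hneg (k : ℕ) : catDist pw pd pl 0 1 0 n (-(k : ℤ)) true = 0 :=
    catDist_safe_true_of_ne_one n _ (by lia)
  have hmass := switchMass_add_sum_eq_one hp n
  rw [Finset.sum_range_succ'] at hmass
  rw [hsum, Finset.sum_insert, Finset.sum_image (by intro a _ b _ h; simpa using h),
    Finset.sum_range_succ']
  · have hs (k : ℕ) : sgn (-((k + 1 : ℕ) : ℤ)) = -1 := by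
      rw [sgn, if_neg (by lia), if_pos (by lia)]
    have h1 : sgn 1 = 1 := by simp [sgn]
    have h0 : sgn (-((0 : ℕ) : ℤ)) = 0 := by simp [sgn]
    simp only [hneg, hs, h1, h0, catDist_false_eq_zero n 1 (by simp)]
    simp only [switchMass, attackMass] at hmass ⊢
    simp only [add_zero, mul_neg, mul_one, mul_zero, Finset.sum_neg_distrib, zero_add]
    linear_combination -hmass
  · simp only [Finset.mem_image, not_exists, not_and]
    intro k _
    lia

/-- Every fixed attacking score is asymptotically deserted. -/
lemma tendsto_attackMass (hpw : 0 < pw) (hpd : 0 ≤ pd) (hpl : 0 ≤ pl)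
    (hp : pw + pd + pl = 1) (k : ℕ) :
    Tendsto (fun n => attackMass pw pd pl n k) atTop (𝓝 0) := by
  have hnn := attackMass_nonneg hpw.le hpd hpl
  have of_mul (f : ℕ → ℝ) (h : Tendsto (fun n => f n * pw) atTop (𝓝 0)) :
      Tendsto f atTop (𝓝 0) := by
    simpa [hpw.ne'] using h.div_const pw
  induction k with
  | zero =>
    have hmono : Monotone (switchMass pw pd pl) := monotone_nat_of_le_succ fun n => by
      rw [switchMass_succ]
      have := hnn n 0
      have : 0 ≤ attackMass pw pd pl n 0 * pw := by positivity
      linarith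
    have hbdd : BddAbove (Set.range (switchMass pw pd pl)) := ⟨1, by
      rintro _ ⟨n, rfl⟩
      have := switchMass_add_sum_eq_one hp n
      have : 0 ≤ ∑ k ∈ range (n + 1), attackMass pw pd pl n k :=
        Finset.sum_nonneg fun k _ => hnn n k
      linarith⟩
    have hlim := tendsto_atTop_ciSup hmono hbdd
    refine of_mul _ ?_
    simpa [switchMass_succ] using ((tendsto_add_atTop_iff_nat 1).2 hlim).sub hlim
  | succ k ih =>
    refine of_mul _ (squeeze_zero (fun n => mul_nonneg (hnn _ _) hpw.le) (fun n => ?_)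
      ((tendsto_add_atTop_iff_nat 1).2 ih))
    have h0 := hnn n k
    have h1 := hnn n (k + 1)
    cases k with
    | zero =>
      rw [attackMass_succ_zero]
      have : 0 ≤ attackMass pw pd pl n 0 * pd := by positivity
      linarith
    | succ k =>
      rw [attackMass_succ_succ]
      have h2 := hnn n k
      have : 0 ≤ attackMass pw pd pl n (k + 1) * pd := by positivity
      have : 0 ≤ attackMass pw pd pl n k * pl := by positivity
      linarith

end SafeDefense

/-- Nonnegative rows that vanish pointwise and have bounded `W`-mass have vanishing `h`-mass
whenever `h = o(W)`. -/
lemma tendsto_sum_range_zero_of_bounded {a : ℕ → ℕ → ℝ} {h W : ℕ → ℝ} {C : ℝ}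
    (ha : ∀ n k, 0 ≤ a n k) (ha0 : ∀ k, Tendsto (fun n => a n k) atTop (𝓝 0))
    (hh : ∀ k, 0 ≤ h k) (hW : ∀ k, 0 ≤ W k)
    (hbdd : ∀ n, ∑ k ∈ range (n + 1), W k * a n k ≤ C)
    (hlittle : ∀ ε > 0, ∃ K, ∀ k ≥ K, h k ≤ ε * W k) :
    Tendsto (fun n => ∑ k ∈ range (n + 1), h k * a n k) atTop (𝓝 0) := by
  have hC : 0 ≤ C := (Finset.sum_nonneg fun k _ => mul_nonneg (hW k) (ha 0 k)).trans (hbdd 0)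
  rw [Metric.tendsto_atTop]
  intro ε hε
  obtain ⟨K, hK⟩ := hlittle (ε / (2 * (C + 1))) (by positivity)
  have hfin : Tendsto (fun n => ∑ k ∈ range K, h k * a n k) atTop (𝓝 0) := by
    simpa using tendsto_finsetSum (range K) fun k _ => (ha0 k).const_mul (h k)
  obtain ⟨N, hN⟩ := (hfin.eventually_lt_const (half_pos hε)).exists_forall_of_atTop
  refine ⟨N, fun n hn => ?_⟩
  rw [Real.dist_eq, sub_zero,
    abs_of_nonneg (Finset.sum_nonneg fun k _ => mul_nonneg (hh k) (ha n k))]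
  have hsplit : ∑ k ∈ range (n + 1), h k * a n k ≤
      ∑ k ∈ range K, h k * a n k +
        ε / (2 * (C + 1)) * ∑ k ∈ range (n + 1), W k * a n k := by
    rw [← Finset.sum_filter_add_sum_filter_not (range (n + 1)) (· < K), Finset.mul_sum]
    refine add_le_add (Finset.sum_le_sum_of_subset_of_nonneg ?_ fun k _ _ =>
      mul_nonneg (hh k) (ha n k)) ?_
    · intro k hk
      simpa using (Finset.mem_filter.1 hk).2
    · refine (Finset.sum_le_sum fun k hk => ?_).trans
        (Finset.sum_le_sum_of_subset_of_nonneg (Finset.filter_subset _ _) fun k _ _ =>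
          mul_nonneg (by positivity) (mul_nonneg (hW k) (ha n k)))
      rw [← mul_assoc]
      exact mul_le_mul_of_nonneg_right (hK k (not_lt.1 (Finset.mem_filter.1 hk).2)) (ha n k)
  have hb : ε / (2 * (C + 1)) * ∑ k ∈ range (n + 1), W k * a n k ≤ ε / 2 := by
    refine (mul_le_mul_of_nonneg_left (hbdd n) (by positivity)).trans ?_
    rw [div_mul_eq_mul_div, div_le_div_iff₀ (by positivity) two_pos]
    nlinarith
  linarith [hN n hn]

/-- Gambler's ruin: a walk with nonpositive drift reaches `+1` with probability `pw / pl`. -/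
lemma tendsto_switchMass {pw pd pl : ℝ} (hpw : 0 < pw) (hpd : 0 ≤ pd) (hpl : 0 < pl)
    (hp : pw + pd + pl = 1) (hweak : pw ≤ pl) :
    Tendsto (switchMass pw pd pl) atTop (𝓝 (pw / pl)) := by
  have hnn := attackMass_nonneg hpw.le hpd hpl.le
  have hswitch := switchMass_nonneg hpw.le hpd hpl.le
  set s := pw / pl with hs
  have hs0 : 0 ≤ s := by positivity
  have hpws : pw = pl * s := by rw [hs]; field_simp
  have hcons (n : ℕ) : switchMass pw pd pl n =
      s - ∑ k ∈ range (n + 1), s ^ (k + 1) * attackMass pw pd pl n k := by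
    have := switchMass_add_sum_eq (pw := pw) (pd := pd) (pl := pl) (fun k => s ^ k)
      (fun k => by
        have hpd' : pd = 1 - pl * s - pl := by linarith
        simp only [hpws, hpd']; ring) n
    simp only [pow_zero, one_mul, pow_one] at this
    linarith
  suffices h : Tendsto
      (fun n => ∑ k ∈ range (n + 1), s ^ (k + 1) * attackMass pw pd pl n k) atTop (𝓝 0) by
    rw [funext hcons]
    simpa using h.const_sub s
  have hvanish := tendsto_attackMass hpw hpd hpl.le hp
  rcases hweak.lt_or_eq with hlt | heq
  · have hs1 : s < 1 := (div_lt_one hpl).2 hlt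
    refine tendsto_sum_range_zero_of_bounded (W := fun _ => 1) (C := 1) hnn hvanish
      (fun k => by positivity) (fun _ => zero_le_one) (fun n => ?_) fun ε hε => ?_
    · have := switchMass_add_sum_eq_one hp n
      have := hswitch n
      simp only [one_mul]
      linarith
    · have h := ((tendsto_add_atTop_iff_nat 1).2
        (tendsto_pow_atTop_nhds_zero_of_lt_one hs0 hs1)).eventually_le_const hε
      simpa using h.exists_forall_of_atTop
  · have hs1 : s = 1 := by rw [hs, heq, div_self hpl.ne']
    refine tendsto_sum_range_zero_of_bounded (W := fun k => ((k + 1 : ℕ) : ℝ)) (C := 1) hnn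
      hvanish (fun k => by positivity) (fun _ => by positivity) (fun n => ?_) fun ε hε => ?_
    · have := switchMass_add_sum_eq (pw := pw) (pd := pd) (pl := pl) (fun k => (k : ℝ))
        (fun k => by
          have hpd' : pd = 1 - pl - pl := by linarith
          simp only [heq, hpd']; push_cast; ring) n
      simp only [Nat.cast_zero, zero_mul, zero_add, Nat.cast_one] at this
      exact this.le
    · obtain ⟨K, hK⟩ := exists_nat_ge (1 / ε)
      refine ⟨K, fun k hk => ?_⟩
      have : (K : ℝ) ≤ k := by exact_mod_cast hk
      rw [hs1, one_pow]
      push_cast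
      rw [div_le_iff₀ hε] at hK
      nlinarith

/-- If the defensive style is safe (`qd = 1`) and `0 < pl`, `pw ≤ pl`,
then the gain of the catenaccio policy converges to `2 pw / pl − 1` as `N → ∞`. -/
theorem catenaccio_gain_tendsto_of_safe_defense
    (pw pd pl qw qd ql : ℝ)
    (hpw : 0 ≤ pw) (hpd : 0 ≤ pd) (hpl : 0 ≤ pl) (hp : pw + pd + pl = 1)
    (hqw : 0 ≤ qw) (hqd : 0 ≤ qd) (hql : 0 ≤ ql) (hq : qw + qd + ql = 1)
    (hsafe : qd = 1) (hpl0 : 0 < pl) (hweak : pw ≤ pl) :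
    Tendsto (fun N : ℕ => gCat pw pd pl qw qd ql N) atTop (𝓝 (2 * pw / pl - 1)) := by
  obtain rfl : qw = 0 := by linarith
  obtain rfl : ql = 0 := by linarith
  subst hsafe
  simp only [gCat_safe_eq hp]
  rcases hpw.lt_or_eq with hpos | rfl
  · have h := (((tendsto_switchMass hpos hpd hpl0 hp hweak).const_mul 2).sub_const 1).add
      (tendsto_attackMass hpos hpd hpl hp 0)
    rwa [add_zero, ← mul_div_assoc] at h
  · have hswitch (n : ℕ) : switchMass 0 pd pl n = 0 := by
      induction n with
      | zero => simp [switchMass, catDist]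
      | succ n ih => simp [switchMass_succ, ih]
    have hattack (n : ℕ) : attackMass 0 pd pl n 0 = pd ^ n := by
      induction n with
      | zero => simp [attackMass, catDist]
      | succ n ih => simp [attackMass_succ_zero, ih, pow_succ]
    simp only [hswitch, hattack]
    simpa using (tendsto_pow_atTop_nhds_zero_of_lt_one hpd (by linarith)).const_add (-1)
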